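/- arXiv:1912.03450 — 4 statements merged into one kernel-verified Lean document; each statement's English description precedes it below -/
import Mathlib

section
/- Let c > 0 and suppose the real constants {H^{αβ}}_{α,β=0..3} satisfy H^{αβ}X_αX_β = 0 for every X ∈ 𝒩^{(c)}. Then for each i ∈ {1,…,7} and all smooth functions v(t,x), w(t,x) on ℝ×ℝ³, one has Z_i(H^{αβ}(∂_αv)(∂_βw)) = H^{αβ}(∂_α Z_i v)(∂_β w) + H^{αβ}(∂_α v)(∂_β Z_i w) + H̃_i^{αβ}(∂_α v)(∂_β w), where the new real constants {H̃_i^{αβ}} also satisfy H̃_i^{αβ}X_αX_β = 0 for every X ∈ 𝒩^{(c)}. -/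
open MeasureTheory Real Set

noncomputable section

namespace MultiSpeedWave

/-- Physical space `ℝ³` with the Euclidean norm. -/
abbrev Sp : Type := EuclideanSpace ℝ (Fin 3)

/-- A space-time point `(t, x)`. -/
abbrev Pt : Type := ℝ × Sp

/-- A scalar field on space-time. -/
abbrev Fn : Type := Pt → ℝ

/-- Time derivative `∂_t`. -/
def pt (v : Fn) : Fn := fun p => fderiv ℝ v p (1, 0)

/-- Spatial derivative `∂_j`. -/
def px (j : Fin 3) (v : Fn) : Fn := fun p => fderiv ℝ v p (0, EuclideanSpace.single j 1)

/-- Space-time derivative `∂_α` (`α = 0` is time). -/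
def pd (α : Fin 4) : Fn → Fn := Fin.cases pt px α

/-- Rotation `Ω_{ij} = x_i ∂_j − x_j ∂_i` (0-based indices). -/
def om (i j : Fin 3) (v : Fn) : Fn := fun p => p.2 i * px j v p - p.2 j * px i v p

/-- Scaling vector field `S = t ∂_t + x·∇`. -/
def sOp (v : Fn) : Fn := fun p => p.1 * pt v p + ∑ j : Fin 3, p.2 j * px j v p

/-- The seven generators `Z_1,…,Z_7 = ∂_1,∂_2,∂_3,Ω_{12},Ω_{23},Ω_{13},S`. -/
def Zop : Fin 7 → Fn → Fn := ![px 0, px 1, px 2, om 0 1, om 1 2, om 0 2, sOp]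

/-- `Z^a` for a multi-index `a`. -/
def Zmulti (a : Fin 7 → ℕ) (v : Fn) : Fn :=
  (List.finRange 7).foldr (fun i w => (Zop i)^[a i] w) v

/-- `∂_x^a` for a spatial multi-index `a`, acting on space-time functions. -/
def pxMulti (a : Fin 3 → ℕ) (v : Fn) : Fn :=
  (List.finRange 3).foldr (fun i w => (px i)^[a i] w) v

/-- `Ω^b = Ω_{12}^{b₁} Ω_{23}^{b₂} Ω_{13}^{b₃}`. -/
def omMulti (b : Fin 3 → ℕ) (v : Fn) : Fn :=
  (om 0 1)^[b 0] ((om 1 2)^[b 1] ((om 0 2)^[b 2] v))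

/-- All multi-indices of length `n` and total degree `≤ m`. -/
def idxSet (n m : ℕ) : Finset (Fin n → ℕ) :=
  (Fintype.piFinset fun _ => Finset.range (m+1)).filter fun a => ∑ i, a i ≤ m

/-- The Japanese bracket `⟨ρ⟩ = (1+ρ²)^{1/2}`. -/
def jb (ρ : ℝ) : ℝ := Real.sqrt (1 + ρ^2)

/-- The d'Alembertian `□_c = ∂_t² − c²Δ`. -/
def boxOp (c : ℝ) (v : Fn) : Fn :=
  fun p => pt (pt v) p - c^2 * ∑ j : Fin 3, px j (px j v) p

/-- Energy `E(v(t);c)`. -/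
def energy (c : ℝ) (v : Fn) (t : ℝ) : ℝ :=
  (1/2) * ∫ x : Sp, ((pt v (t,x))^2 + c^2 * ∑ j : Fin 3, (px j v (t,x))^2)

/-- Generalized energy `N_κ(v(t);c)`. -/
def Nnorm (κ : ℕ) (c : ℝ) (v : Fn) (t : ℝ) : ℝ :=
  Real.sqrt (∑ a ∈ idxSet 7 (κ-1), energy c (Zmulti a v) t)

/-- `L²(ℝ³)` norm. -/
def L2 (f : Sp → ℝ) : ℝ := Real.sqrt (∫ x : Sp, (f x)^2)

/-- The auxiliary norm `M₂(v(t);c)`. -/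
def M2 (c : ℝ) (v : Fn) (t : ℝ) : ℝ :=
  ∑ α : Fin 4, ∑ j : Fin 3, L2 (fun x => jb (c*t - ‖x‖) * pd α (px j v) (t,x))

/-- The auxiliary norm `M_μ(v(t);c)`. -/
def Mmu (μ : ℕ) (c : ℝ) (v : Fn) (t : ℝ) : ℝ :=
  ∑ a ∈ idxSet 7 (μ-2), M2 c (Zmulti a v) t

/-- The good derivative `T_j^{(c)} = c ∂_j + (x_j/|x|) ∂_t`. -/
def Tder (c : ℝ) (j : Fin 3) (v : Fn) : Fn :=
  fun p => c * px j v p + (p.2 j / ‖p.2‖) * pt v p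

/-- `|T^{(c)} v|`. -/
def Tnorm (c : ℝ) (v : Fn) (p : Pt) : ℝ := Real.sqrt (∑ j : Fin 3, (Tder c j v p)^2)

/-- `|∂v|` (full space-time gradient). -/
def pdNorm (v : Fn) (p : Pt) : ℝ := Real.sqrt (∑ α : Fin 4, (pd α v p)^2)

/-- `|∂_x v|` (spatial gradient). -/
def pxNorm (v : Fn) (p : Pt) : ℝ := Real.sqrt (∑ j : Fin 3, (px j v p)^2)

/-- `L^∞(ℝ³)` norm. -/
def Linf (f : Sp → ℝ) : ℝ := ⨆ x : Sp, |f x|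

/-- `L⁶(ℝ³)` norm. -/
def L6 (f : Sp → ℝ) : ℝ := (∫ x : Sp, |f x|^6) ^ ((1:ℝ)/6)

/-- The unit sphere `S²`. -/
abbrev S2 := Metric.sphere (0 : Sp) 1

/-- Surface measure on the unit sphere. -/
def sphMeas : Measure S2 := (volume : Measure Sp).toSphere

/-- `‖f(r·)‖_{L⁴(S²)}`. -/
def L4sph (f : Sp → ℝ) (r : ℝ) : ℝ :=
  (∫ ω : S2, |f (r • (ω : Sp))|^4 ∂sphMeas) ^ ((1:ℝ)/4)

/-- Mixed norm `‖f‖_{L_r^∞ L_ω^4}`. -/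
def LinfrL4 (f : Sp → ℝ) : ℝ := ⨆ r : Set.Ioi (0:ℝ), L4sph f (r : ℝ)

/-- Spatial derivative for functions of `x` only. -/
def dxj (j : Fin 3) (f : Sp → ℝ) : Sp → ℝ := fun x => fderiv ℝ f x (EuclideanSpace.single j 1)

/-- `∂_x^a` for functions of `x` only. -/
def dxMulti (a : Fin 3 → ℕ) (f : Sp → ℝ) : Sp → ℝ :=
  (List.finRange 3).foldr (fun i w => (dxj i)^[a i] w) f

/-- The null condition for coefficients `{H^{αβ}}` relative to the cone `𝒩^{(c)}`. -/
def nullCond (c : ℝ) (H : Fin 4 → Fin 4 → ℝ) : Prop :=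
  ∀ X : Fin 4 → ℝ, (X 0)^2 = c^2 * ((X 1)^2 + (X 2)^2 + (X 3)^2) →
    ∑ α : Fin 4, ∑ β : Fin 4, H α β * X α * X β = 0

/-- The quadratic form `H^{αβ}(∂_α v)(∂_β w)`. -/
def nullQ (H : Fin 4 → Fin 4 → ℝ) (v w : Fn) : Fn :=
  fun p => ∑ α : Fin 4, ∑ β : Fin 4, H α β * pd α v p * pd β w p

/-- Coefficients `F_i^{jk,αβ}` of the quadratic part. -/
abbrev Coef := Fin 3 → Fin 3 → Fin 3 → Fin 4 → Fin 4 → ℝ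

/-- The speeds `c₁ = c₂ = 1`, `c₃ = c₀`. -/
def cspeed (c0 : ℝ) : Fin 3 → ℝ := ![1, 1, c0]

/-- Evaluation of a cubic remainder at the gradients of `u`. -/
def cubicEval (P : MvPolynomial (Fin 3 × Fin 4) ℝ) (u : Fin 3 → Fn) : Fn :=
  fun p => MvPolynomial.eval (fun q => pd q.2 (u q.1) p) P

/-- Every monomial has degree at least 3. -/
def CubicLike (P : MvPolynomial (Fin 3 × Fin 4) ℝ) : Prop :=
  ∀ m ∈ P.support, 3 ≤ m.sum fun _ e => e

/-- The right-hand side `F_i(∂u)`. -/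
def rhs (F : Coef) (Cub : Fin 3 → MvPolynomial (Fin 3 × Fin 4) ℝ)
    (u : Fin 3 → Fn) (i : Fin 3) : Fn :=
  fun p => (∑ j : Fin 3, ∑ k : Fin 3, ∑ α : Fin 4, ∑ β : Fin 4,
      F i j k α β * pd α (u j) p * pd β (u k) p) + cubicEval (Cub i) u p

/-- `u` solves the system for times in `s`. -/
def IsSolutionOn (c0 : ℝ) (F : Coef) (Cub : Fin 3 → MvPolynomial (Fin 3 × Fin 4) ℝ)
    (u : Fin 3 → Fn) (s : Set ℝ) : Prop :=
  ∀ i : Fin 3, ∀ t ∈ s, ∀ x : Sp, boxOp (cspeed c0 i) (u i) (t,x) = rhs F Cub u i (t,x)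

/-- `F_i^{jk} = 0` for `j > k`. -/
def LowerTri (F : Coef) : Prop :=
  ∀ (i j k : Fin 3), (k : ℕ) < (j : ℕ) → ∀ (α β : Fin 4), F i j k α β = 0

/-- Structural condition (C1). -/
def CondC1 (F : Coef) : Prop := nullCond 1 (F 0 0 0)

/-- Structural condition (C2). -/
def CondC2 (F : Coef) : Prop :=
  nullCond 1 (F 1 0 0) ∧ nullCond 1 (F 1 0 1) ∧ nullCond 1 (F 1 1 1)

/-- Structural condition (C3). -/
def CondC3 (c0 : ℝ) (F : Coef) : Prop := nullCond c0 (F 2 2 2)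

/-- Structural condition (C4). -/
def CondC4 (F : Coef) : Prop := ∀ (α β : Fin 4), F 1 0 2 α β = 0

/-- Structural condition (C5). -/
def CondC5 (F : Coef) : Prop := ∀ (α β : Fin 4), F 2 0 2 α β = 0

/-- Structural condition (C6). -/
def CondC6 (F : Coef) : Prop := nullCond 1 (F 2 0 0) ∧ nullCond 1 (F 2 0 1)

/-- The data norm `‖(f,g)‖_D`. -/
def dataNorm (f g : Fin 3 → Sp → ℝ) : ℝ :=
  ∑ i : Fin 3,
    ((∑ a ∈ (idxSet 3 4).filter (fun a => 1 ≤ ∑ j, a j),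
        L2 (fun x => jb ‖x‖ ^ ((∑ j, a j) - 1) * dxMulti a (f i) x))
      + ∑ a ∈ idxSet 3 3, L2 (fun x => jb ‖x‖ ^ (∑ j, a j) * dxMulti a (g i) x))

/-- The weights `σ₁ = δ`, `σ₂ = σ₃ = 0`. -/
def sig (δ : ℝ) : Fin 3 → ℝ := ![δ, 0, 0]

/-- Weighted `L^∞` norm of a gradient. -/
def wInf (w : Sp → ℝ) (v : Fn) (t : ℝ) : ℝ := Linf fun x => w x * pdNorm v (t,x)

/-- Weighted `L_r^∞ L_ω^4` norm of a gradient. -/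
def wL4 (w : Sp → ℝ) (v : Fn) (t : ℝ) : ℝ := LinfrL4 fun x => w x * pdNorm v (t,x)

/-- Weighted `L⁶` norm of a gradient. -/
def wL6 (w : Sp → ℝ) (v : Fn) (t : ℝ) : ℝ := L6 fun x => w x * pdNorm v (t,x)

/-- The collection of weighted pointwise norms `⟨⟨u(t)⟩⟩`. -/
def bigBracket (c0 δ : ℝ) (u : Fin 3 → Fn) (t : ℝ) : ℝ :=
  (∑ i : Fin 3, jb t ^ (-(sig δ i)) *
     wInf (fun x => ‖x‖ * Real.sqrt (jb (cspeed c0 i * t - ‖x‖))) (u i) t)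
  + (∑ i : Fin 3, ∑ a ∈ idxSet 7 1, jb t ^ (-(sig δ i) - δ) *
     wInf (fun x => ‖x‖ * Real.sqrt (jb (cspeed c0 i * t - ‖x‖))) (Zmulti a (u i)) t)
  + (∑ i : Fin 3, ∑ a ∈ idxSet 7 1, jb t ^ (-(sig δ i)) *
     (wL4 (fun x => Real.sqrt ‖x‖ * jb (cspeed c0 i * t - ‖x‖)) (Zmulti a (u i)) t
      + ∑ j : Fin 7, LinfrL4 fun x => Real.sqrt ‖x‖ * Zop j (Zmulti a (u i)) (t,x)))
  + (∑ i : Fin 3, ∑ a ∈ idxSet 7 2, jb t ^ (-(sig δ i) - δ) *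
     (wL4 (fun x => Real.sqrt ‖x‖ * jb (cspeed c0 i * t - ‖x‖)) (Zmulti a (u i)) t
      + ∑ j : Fin 7, LinfrL4 fun x => Real.sqrt ‖x‖ * Zop j (Zmulti a (u i)) (t,x)))
  + (∑ i : Fin 3, ∑ a ∈ idxSet 7 1, jb t ^ (-(sig δ i)) *
     wL4 (fun x => ‖x‖) (Zmulti a (u i)) t)
  + (∑ i : Fin 3, jb t ^ (-(sig δ i)) *
     wInf (fun x => jb (cspeed c0 i * t - ‖x‖)) (u i) t)
  + (jb t ^ (-δ) * ∑ i : Fin 3, ∑ a ∈ idxSet 7 1, jb t ^ (-(sig δ i)) *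
     wInf (fun x => jb (cspeed c0 i * t - ‖x‖)) (Zmulti a (u i)) t)
  + (∑ i : Fin 3, ∑ a ∈ idxSet 7 1, jb t ^ (-(sig δ i)) *
     wL6 (fun x => jb (cspeed c0 i * t - ‖x‖)) (Zmulti a (u i)) t)

/-- `⟨⟨u⟩⟩_T = sup_{0<t<T} ⟨⟨u(t)⟩⟩`. -/
def bigBracketSup (c0 δ T : ℝ) (u : Fin 3 → Fn) : ℝ :=
  ⨆ t : Set.Ioo (0:ℝ) T, bigBracket c0 δ u t

/-- `sup_{0<t<T} f(t)`. -/
def supIoo (T : ℝ) (f : ℝ → ℝ) : ℝ := ⨆ t : Set.Ioo (0:ℝ) T, f t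

/-- `𝒩_κ(u(t))`. -/
def calN (c0 δ : ℝ) (κ : ℕ) (u : Fin 3 → Fn) (t : ℝ) : ℝ :=
  jb t ^ (-δ) * Nnorm κ 1 (u 0) t + Nnorm κ 1 (u 1) t + Nnorm κ c0 (u 2) t

/-- `ℳ_κ(u(t))`. -/
def calM (c0 δ : ℝ) (κ : ℕ) (u : Fin 3 → Fn) (t : ℝ) : ℝ :=
  jb t ^ (-δ) * Mmu κ 1 (u 0) t + Mmu κ 1 (u 1) t + Mmu κ c0 (u 2) t

/-- The ghost-weight quantity `G(v(t);c)` (with parameter `η`). -/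
def Gnorm (η c : ℝ) (v : Fn) (t : ℝ) : ℝ :=
  Real.sqrt (∑ a ∈ idxSet 7 3, ∑ j : Fin 3,
    ∫ x : Sp, jb (c*t - ‖x‖) ^ (-1 - 2*η) * (Tder c j (Zmulti a v) (t,x))^2)

/-- The Keel–Smith–Sogge type local-energy norm `L(v(t))`. -/
def Lnorm (v : Fn) (t : ℝ) : ℝ :=
  Real.sqrt (∑ a ∈ idxSet 7 3,
    ((∫ x : Sp, (‖x‖ ^ (-(5:ℝ)/4) * Zmulti a v (t,x))^2) +
     ∑ α : Fin 4, ∫ x : Sp, (‖x‖ ^ (-(1:ℝ)/4) * pd α (Zmulti a v) (t,x))^2))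

/-- A smooth local solution on `(0,T)×ℝ³`, compactly supported in `x`. -/
def LocalSolution (c0 : ℝ) (F : Coef) (Cub : Fin 3 → MvPolynomial (Fin 3 × Fin 4) ℝ)
    (T : ℝ) (u : Fin 3 → Fn) : Prop :=
  (∀ i, ContDiff ℝ (⊤ : ℕ∞) (u i)) ∧
  (∀ i t, HasCompactSupport fun x => u i (t, x)) ∧
  IsSolutionOn c0 F Cub u (Set.Ioo 0 T)

/-- A global solution of the Cauchy problem with data `(f,g)`. -/
def IsGlobalSolution (c0 : ℝ) (F : Coef) (Cub : Fin 3 → MvPolynomial (Fin 3 × Fin 4) ℝ)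
    (f g : Fin 3 → Sp → ℝ) (u : Fin 3 → Fn) : Prop :=
  (∀ i, ContDiff ℝ (⊤ : ℕ∞) (u i)) ∧
  IsSolutionOn c0 F Cub u (Set.Ioi 0) ∧
  (∀ i x, u i (0, x) = f i x ∧ pt (u i) (0, x) = g i x)

end MultiSpeedWave
namespace MultiSpeedWave

/-- A coefficient matrix satisfies the null condition iff its symmetric part is a multiple of
`diag(1, -c², -c², -c²)`. -/
theorem nullCond_iff {c : ℝ} (hc : 0 < c) (H : Fin 4 → Fin 4 → ℝ) :
    nullCond c H ↔
      (H 0 1 + H 1 0 = 0 ∧ H 0 2 + H 2 0 = 0 ∧ H 0 3 + H 3 0 = 0) ∧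
      (H 1 2 + H 2 1 = 0 ∧ H 2 3 + H 3 2 = 0 ∧ H 1 3 + H 3 1 = 0) ∧
      (H 1 1 = -(c ^ 2 * H 0 0) ∧ H 2 2 = -(c ^ 2 * H 0 0) ∧ H 3 3 = -(c ^ 2 * H 0 0)) := by
  constructor
  · intro hH
    have key : ∀ t x y z : ℝ, t ^ 2 = x ^ 2 + y ^ 2 + z ^ 2 →
        c ^ 2 * t ^ 2 * H 0 0 + c * t * x * (H 0 1 + H 1 0) + c * t * y * (H 0 2 + H 2 0)
          + c * t * z * (H 0 3 + H 3 0) + x * y * (H 1 2 + H 2 1) + y * z * (H 2 3 + H 3 2)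
          + x * z * (H 1 3 + H 3 1) + x ^ 2 * H 1 1 + y ^ 2 * H 2 2 + z ^ 2 * H 3 3 = 0 := by
      intro t x y z h
      have := hH ![c * t, x, y, z] (by simp [mul_pow, h])
      simp [Fin.sum_univ_four] at this
      linear_combination this
    have cancel : ∀ s : ℝ, c * s = 0 → s = 0 := fun s hs =>
      (mul_eq_zero.mp hs).resolve_left hc.ne'
    have x₁ := key 1 1 0 0 (by norm_num)
    have x₂ := key 1 (-1) 0 0 (by norm_num)
    have y₁ := key 1 0 1 0 (by norm_num)
    have y₂ := key 1 0 (-1) 0 (by norm_num)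
    have z₁ := key 1 0 0 1 (by norm_num)
    have z₂ := key 1 0 0 (-1) (by norm_num)
    have h₁ : H 0 1 + H 1 0 = 0 := cancel _ (by linarith)
    have h₂ : H 0 2 + H 2 0 = 0 := cancel _ (by linarith)
    have h₃ : H 0 3 + H 3 0 = 0 := cancel _ (by linarith)
    have xy := key 5 3 4 0 (by norm_num)
    have yz := key 5 0 3 4 (by norm_num)
    have xz := key 5 3 0 4 (by norm_num)
    rw [h₁, h₂, h₃] at xy yz xz
    refine ⟨⟨h₁, h₂, h₃⟩, ⟨?_, ?_, ?_⟩, ?_, ?_, ?_⟩ <;> linarith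
  · rintro ⟨⟨h₁, h₂, h₃⟩, ⟨h₄, h₅, h₆⟩, h₇, h₈, h₉⟩ X hX
    simp only [Fin.sum_univ_four]
    linear_combination H 0 0 * hX + X 0 * X 1 * h₁ + X 0 * X 2 * h₂ + X 0 * X 3 * h₃
      + X 1 * X 2 * h₄ + X 2 * X 3 * h₅ + X 1 * X 3 * h₆
      + X 1 ^ 2 * h₇ + X 2 ^ 2 * h₈ + X 3 ^ 2 * h₉

/-- The standard basis of space-time. -/
def basisVec (α : Fin 4) : Pt :=
  Fin.cases (1, 0) (fun j => (0, EuclideanSpace.single j 1)) α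

theorem pd_eq_fderiv (α : Fin 4) (v : Fn) (p : Pt) :
    pd α v p = fderiv ℝ v p (basisVec α) := by
  cases α using Fin.cases <;> rfl

theorem contDiff_pd (α : Fin 4) {v : Fn} (hv : ContDiff ℝ (⊤ : ℕ∞) v) :
    ContDiff ℝ (⊤ : ℕ∞) (pd α v) := by
  rw [funext (pd_eq_fderiv α v)]
  exact (hv.fderiv_right (m := (⊤ : ℕ∞)) (by simp)).clm_apply contDiff_const

theorem pd_comm (α β : Fin 4) {v : Fn} (hv : ContDiff ℝ (⊤ : ℕ∞) v) (p : Pt) :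
    pd α (pd β v) p = pd β (pd α v) p := by
  have hd : DifferentiableAt ℝ (fderiv ℝ v) p :=
    (hv.fderiv_right (m := (⊤ : ℕ∞)) (by simp)).differentiable (by simp) p
  have hsymm : IsSymmSndFDerivAt ℝ v p :=
    hv.contDiffAt.isSymmSndFDerivAt (by
      rw [minSmoothness_of_isRCLikeNormedField]
      exact WithTop.coe_le_coe.mpr le_top)
  have h : ∀ α β : Fin 4, pd α (pd β v) p =
      fderiv ℝ (fderiv ℝ v) p (basisVec α) (basisVec β) := by
    intro α β
    rw [pd_eq_fderiv, funext (pd_eq_fderiv β v), fderiv_clm_apply hd (by fun_prop)]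
    simp
  rw [h, h, hsymm.eq]

theorem pd_mul (α : Fin 4) {f g : Fn} {p : Pt} (hf : DifferentiableAt ℝ f p)
    (hg : DifferentiableAt ℝ g p) :
    pd α (fun q => f q * g q) p = pd α f p * g p + f p * pd α g p := by
  simp only [pd_eq_fderiv]
  rw [fderiv_fun_mul hf hg]
  simp
  ring

theorem pd_sum {ι : Type*} (s : Finset ι) (α : Fin 4) {f : ι → Fn} {p : Pt}
    (hf : ∀ i ∈ s, DifferentiableAt ℝ (f i) p) :
    pd α (fun q => ∑ i ∈ s, f i q) p = ∑ i ∈ s, pd α (f i) p := by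
  simp only [pd_eq_fderiv]
  rw [fderiv_fun_sum hf]
  simp

theorem pd_const_mul (α : Fin 4) (r : ℝ) {f : Fn} {p : Pt} (hf : DifferentiableAt ℝ f p) :
    pd α (fun q => r * f q) p = r * pd α f p := by
  simp only [pd_eq_fderiv]
  rw [fderiv_const_mul hf]
  simp

/-- The coordinate functions of space-time. -/
def coord (α : Fin 4) : Fn := fun p => Fin.cases p.1 (fun j => p.2 j) α

theorem differentiable_coord (α : Fin 4) : Differentiable ℝ (coord α) := by
  cases α using Fin.cases with
  | zero => exact differentiable_fst
  | succ j =>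
    change Differentiable ℝ fun p : Pt => p.2 j
    fun_prop

theorem pd_coord (α β : Fin 4) (p : Pt) :
    pd α (coord β) p = if β = α then 1 else 0 := by
  rw [pd_eq_fderiv]
  cases β using Fin.cases with
  | zero =>
    have : HasFDerivAt (coord 0) (ContinuousLinearMap.fst ℝ ℝ Sp) p := hasFDerivAt_fst
    rw [this.fderiv]
    cases α using Fin.cases with
    | zero => simp [basisVec]
    | succ j => simp [basisVec, (Fin.succ_ne_zero j).symm]
  | succ k =>
    have : HasFDerivAt (coord k.succ)
        ((EuclideanSpace.proj k).comp (ContinuousLinearMap.snd ℝ ℝ Sp)) p :=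
      ((EuclideanSpace.proj k).comp (ContinuousLinearMap.snd ℝ ℝ Sp)).hasFDerivAt
    rw [this.fderiv]
    cases α using Fin.cases with
    | zero => simp [basisVec]
    | succ j => simp [basisVec]

/-- The vector field with coefficient functions `ξ`. -/
def vectorField (ξ : Fin 4 → Fn) (v : Fn) : Fn := fun p => ∑ γ, ξ γ p * pd γ v p

/-- The coefficients of the form arising as the commutator of a null form with a vector field
whose coefficient functions have the constant derivatives `a γ α = ∂_α ξ_γ`. -/
def commCoef (a H : Fin 4 → Fin 4 → ℝ) : Fin 4 → Fin 4 → ℝ :=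
  fun α β => -∑ γ, (a α γ * H γ β + a β γ * H α γ)

theorem pd_vectorField {ξ : Fin 4 → Fn} (hξ : ∀ γ, Differentiable ℝ (ξ γ))
    {a : Fin 4 → Fin 4 → ℝ} (ha : ∀ γ α p, pd α (ξ γ) p = a γ α)
    {v : Fn} (hv : ContDiff ℝ (⊤ : ℕ∞) v) (α : Fin 4) (p : Pt) :
    pd α (vectorField ξ v) p =
      vectorField ξ (pd α v) p + ∑ γ, a γ α * pd γ v p := by
  have hd : ∀ γ, DifferentiableAt ℝ (pd γ v) p := fun γ =>
    (contDiff_pd γ hv).differentiable (by simp) p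
  unfold vectorField
  rw [pd_sum _ _ fun γ _ => (hξ γ p).fun_mul (hd γ), ← Finset.sum_add_distrib]
  refine Finset.sum_congr rfl fun γ _ => ?_
  rw [pd_mul α (hξ γ p) (hd γ), ha, pd_comm α γ hv]
  ring

theorem vectorField_nullQ {ξ : Fin 4 → Fn} (hξ : ∀ γ, Differentiable ℝ (ξ γ))
    {a : Fin 4 → Fin 4 → ℝ} (ha : ∀ γ α p, pd α (ξ γ) p = a γ α)
    (H : Fin 4 → Fin 4 → ℝ) {v w : Fn} (hv : ContDiff ℝ (⊤ : ℕ∞) v)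
    (hw : ContDiff ℝ (⊤ : ℕ∞) w) (p : Pt) :
    vectorField ξ (nullQ H v w) p =
      nullQ H (vectorField ξ v) w p + nullQ H v (vectorField ξ w) p
        + nullQ (commCoef a H) v w p := by
  have hdv : ∀ γ, DifferentiableAt ℝ (pd γ v) p := fun γ =>
    (contDiff_pd γ hv).differentiable (by simp) p
  have hdw : ∀ γ, DifferentiableAt ℝ (pd γ w) p := fun γ =>
    (contDiff_pd γ hw).differentiable (by simp) p
  have hQ : ∀ γ, pd γ (nullQ H v w) p =
      ∑ α, ∑ β, (H α β * pd γ (pd α v) p * pd β w p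
        + H α β * pd α v p * pd γ (pd β w) p) := by
    intro γ
    unfold nullQ
    rw [pd_sum _ _ fun α _ => DifferentiableAt.fun_sum fun β _ =>
      ((hdv α).const_mul (H α β)).fun_mul (hdw β)]
    refine Finset.sum_congr rfl fun α _ => ?_
    rw [pd_sum _ _ fun β _ => ((hdv α).const_mul (H α β)).fun_mul (hdw β)]
    refine Finset.sum_congr rfl fun β _ => ?_
    rw [pd_mul γ ((hdv α).const_mul (H α β)) (hdw β), pd_const_mul γ _ (hdv α)]
  have hZ : vectorField ξ (nullQ H v w) p =
      ∑ α, ∑ β, (H α β * vectorField ξ (pd α v) p * pd β w p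
        + H α β * pd α v p * vectorField ξ (pd β w) p) := by
    simp only [vectorField, hQ, Finset.mul_sum, Finset.sum_mul, ← Finset.sum_add_distrib]
    rw [Finset.sum_comm]
    refine Finset.sum_congr rfl fun α _ => ?_
    rw [Finset.sum_comm]
    refine Finset.sum_congr rfl fun β _ => Finset.sum_congr rfl fun γ _ => by ring
  rw [hZ]
  simp only [nullQ, pd_vectorField hξ ha hv, pd_vectorField hξ ha hw, commCoef,
    Fin.sum_univ_four]
  ring

/-- The commutator of a null form with a vector field of constant derivatives `a` is a null form
when `a` is a multiple of the identity plus an infinitesimal spatial rotation. -/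
theorem nullCond_commCoef {c : ℝ} (hc : 0 < c) {H a : Fin 4 → Fin 4 → ℝ} (hH : nullCond c H)
    (m : ℝ) (h₀ : ∀ j : Fin 3, a 0 j.succ = 0 ∧ a j.succ 0 = 0)
    (ha : ∀ α β, a α β + a β α = if α = β then 2 * m else 0) :
    nullCond c (commCoef a H) := by
  rw [nullCond_iff hc] at hH ⊢
  obtain ⟨⟨h₁, h₂, h₃⟩, ⟨h₄, h₅, h₆⟩, h₇, h₈, h₉⟩ := hH
  have diag : ∀ α, a α α = m := fun α => by linarith [(ha α α).trans (if_pos rfl)]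
  have anti : ∀ α β, α ≠ β → a β α = -a α β := fun α β hαβ => by
    linarith [(ha α β).trans (if_neg hαβ)]
  have e₁ : a 0 1 = 0 ∧ a 1 0 = 0 := h₀ 0
  have e₂ : a 0 2 = 0 ∧ a 2 0 = 0 := h₀ 1
  have e₃ : a 0 3 = 0 ∧ a 3 0 = 0 := h₀ 2
  simp only [commCoef, Fin.sum_univ_four, diag, e₁, e₂, e₃, anti 1 2 (by decide),
    anti 2 3 (by decide), anti 1 3 (by decide)]
  refine ⟨⟨?_, ?_, ?_⟩, ⟨?_, ?_, ?_⟩, ?_, ?_, ?_⟩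
  · linear_combination (-2 * m) * h₁ - a 1 2 * h₂ - a 1 3 * h₃
  · linear_combination (-2 * m) * h₂ + a 1 2 * h₁ - a 2 3 * h₃
  · linear_combination (-2 * m) * h₃ + a 1 3 * h₁ + a 2 3 * h₂
  · linear_combination (-2 * m) * h₄ + 2 * a 1 2 * (h₇ - h₈) - a 1 3 * h₅ - a 2 3 * h₆
  · linear_combination (-2 * m) * h₅ + 2 * a 2 3 * (h₈ - h₉) + a 1 2 * h₆ + a 1 3 * h₄
  · linear_combination (-2 * m) * h₆ + 2 * a 1 3 * (h₇ - h₉) - a 1 2 * h₅ + a 2 3 * h₄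
  · linear_combination (-2 * m) * h₇ - a 1 2 * h₄ - a 1 3 * h₆
  · linear_combination (-2 * m) * h₈ + a 1 2 * h₄ - a 2 3 * h₅
  · linear_combination (-2 * m) * h₉ + a 1 3 * h₆ + a 2 3 * h₅

/-- The coefficient functions of the affine vector field with linear part `a` and constant
part `b`. -/
def affineCoef (a : Fin 4 → Fin 4 → ℝ) (b : Fin 4 → ℝ) (γ : Fin 4) : Fn :=
  fun p => b γ + ∑ α, a γ α * coord α p

theorem differentiable_affineCoef (a : Fin 4 → Fin 4 → ℝ) (b : Fin 4 → ℝ) (γ : Fin 4) :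
    Differentiable ℝ (affineCoef a b γ) :=
  (Differentiable.fun_sum fun α _ => (differentiable_coord α).const_mul (a γ α)).const_add _

theorem pd_affineCoef (a : Fin 4 → Fin 4 → ℝ) (b : Fin 4 → ℝ) (γ α : Fin 4) (p : Pt) :
    pd α (affineCoef a b γ) p = a γ α := by
  have h : pd α (affineCoef a b γ) p = pd α (fun q => ∑ δ, a γ δ * coord δ q) p := by
    rw [pd_eq_fderiv, pd_eq_fderiv]
    unfold affineCoef
    rw [fderiv_const_add]
  rw [h, pd_sum _ _ fun δ _ => (differentiable_coord δ p).const_mul _]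
  simp [pd_const_mul _ _ (differentiable_coord _ p), pd_coord]

theorem exists_nullCond_of_affine {c : ℝ} (hc : 0 < c) {H : Fin 4 → Fin 4 → ℝ}
    (hH : nullCond c H) (a : Fin 4 → Fin 4 → ℝ) (b : Fin 4 → ℝ) (m : ℝ)
    (h₀ : ∀ j : Fin 3, a 0 j.succ = 0 ∧ a j.succ 0 = 0)
    (ha : ∀ α β, a α β + a β α = if α = β then 2 * m else 0)
    {Z : Fn → Fn} (hZ : ∀ v p, Z v p = vectorField (affineCoef a b) v p) :
    ∃ H' : Fin 4 → Fin 4 → ℝ, nullCond c H' ∧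
      ∀ v w : Fn, ContDiff ℝ (⊤ : ℕ∞) v → ContDiff ℝ (⊤ : ℕ∞) w → ∀ p : Pt,
        Z (nullQ H v w) p = nullQ H (Z v) w p + nullQ H v (Z w) p + nullQ H' v w p := by
  obtain rfl : Z = vectorField (affineCoef a b) := funext fun v => funext (hZ v)
  exact ⟨commCoef a H, nullCond_commCoef hc hH m h₀ ha, fun v w hv hw p =>
    vectorField_nullQ (differentiable_affineCoef a b) (pd_affineCoef a b) H hv hw p⟩

/-- The null form is preserved under differentiation by the generators. -/
theorem null_form_preserved (c : ℝ) (hc : 0 < c) (H : Fin 4 → Fin 4 → ℝ)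
    (hH : nullCond c H) (i : Fin 7) :
    ∃ H' : Fin 4 → Fin 4 → ℝ, nullCond c H' ∧
      ∀ v w : Fn, ContDiff ℝ (⊤ : ℕ∞) v → ContDiff ℝ (⊤ : ℕ∞) w → ∀ p : Pt,
        Zop i (nullQ H v w) p =
          nullQ H (Zop i v) w p + nullQ H v (Zop i w) p + nullQ H' v w p := by
  have trans : ∀ j : Fin 3, _ := fun j =>
    exists_nullCond_of_affine hc hH 0 (Pi.single j.succ 1) 0 (by simp) (by simp)
      (Z := px j) (fun v p => by
        simp [vectorField, affineCoef, Pi.single_apply, pd])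
  have rot : ∀ j k : Fin 3, _ := fun j k =>
    exists_nullCond_of_affine hc hH
      (fun γ α => (if γ = k.succ ∧ α = j.succ then 1 else 0)
        - (if γ = j.succ ∧ α = k.succ then 1 else 0)) 0 0
      (fun l => by simp [(Fin.succ_ne_zero _).symm])
      (fun α β => by simp [and_comm])
      (Z := om j k) (fun v p => by
        simp [vectorField, affineCoef, om, pd, coord, sub_mul, ite_and,
          Finset.sum_sub_distrib])
  have scal := exists_nullCond_of_affine hc hH
      (fun γ α => if γ = α then 1 else 0) 0 1
      (fun l => by simp [(Fin.succ_ne_zero _).symm])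
      (fun α β => by
        simp only [eq_comm (a := β)]
        split_ifs <;> norm_num)
      (Z := sOp) (fun v p => by
        simp [vectorField, affineCoef, sOp, pd, coord, Fin.sum_univ_succ])
  fin_cases i
  exacts [trans 0, trans 1, trans 2, rot 0 1, rot 1 2, rot 0 2, scal]

end MultiSpeedWave
end
end

section
/- Let c > 0 and suppose the real constants {H^{αβ}}_{α,β=0..3} satisfy H^{αβ}X_αX_β = 0 for every X ∈ 𝒩^{(c)}. Then there is a constant C = C({H^{αβ}}) such that for all smooth functions v(t,x) and w(t,x) and all (t,x) with x ≠ 0: |H^{αβ}(∂_αv)(∂_βw)| ≤ C(|T^{(c)}v||∂w| + |∂v||T^{(c)}w|). -/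
open MeasureTheory Real Set

noncomputable section

namespace MultiSpeedWave

/-- A bilinear form is bounded by the sum of its absolute coefficients on sup-bounded vectors. -/
lemma abs_sum_bilin_le {ι : Type*} [Fintype ι] (H : ι → ι → ℝ) (U V : ι → ℝ) {u v : ℝ}
    (hu : 0 ≤ u) (hU : ∀ α, |U α| ≤ u) (hV : ∀ α, |V α| ≤ v) :
    |∑ α, ∑ β, H α β * U α * V β| ≤ (∑ α, ∑ β, |H α β|) * (u * v) := by
  simp only [Finset.sum_mul]
  refine (Finset.abs_sum_le_sum_abs _ _).trans (Finset.sum_le_sum fun α _ => ?_)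
  refine (Finset.abs_sum_le_sum_abs _ _).trans (Finset.sum_le_sum fun β _ => ?_)
  rw [abs_mul, abs_mul, mul_assoc]
  exact mul_le_mul_of_nonneg_left (mul_le_mul (hU α) (hV β) (abs_nonneg _) hu) (abs_nonneg _)

/-- If `H` vanishes on `(X, X)`, then modulo `X` only one slot of `H` can be non-tangential. -/
lemma sum_bilin_eq_of_null {ι : Type*} [Fintype ι] (H : ι → ι → ℝ) {X : ι → ℝ}
    (hX : ∑ α, ∑ β, H α β * X α * X β = 0) (s r : ℝ) (a b : ι → ℝ) :
    ∑ α, ∑ β, H α β * a α * b β =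
      (∑ α, ∑ β, H α β * (a α - s * X α) * b β) +
        ∑ α, ∑ β, H α β * (s * X α) * (b β - r * X β) := by
  have h : (∑ α, ∑ β, H α β * (s * X α) * (r * X β)) = 0 := by
    calc (∑ α, ∑ β, H α β * (s * X α) * (r * X β))
        = (s * r) * ∑ α, ∑ β, H α β * X α * X β := by
          simp only [Finset.mul_sum]
          exact Finset.sum_congr rfl fun α _ => Finset.sum_congr rfl fun β _ => by ring
      _ = 0 := by rw [hX, mul_zero]
  rw [← add_zero (_ + _), ← h]
  simp only [← Finset.sum_add_distrib]
  exact Finset.sum_congr rfl fun α _ => Finset.sum_congr rfl fun β _ => by ring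

/-- The null covector `(1, -x / (c|x|))`. -/
def nullCovector (c : ℝ) (x : Sp) : Fin 4 → ℝ :=
  Fin.cases 1 fun j => -(x j / ‖x‖) / c

lemma sum_sq_div_norm {x : Sp} (hx : x ≠ 0) : ∑ j : Fin 3, (x j / ‖x‖) ^ 2 = 1 := by
  simp only [div_pow, ← Finset.sum_div, ← EuclideanSpace.real_norm_sq_eq]
  exact div_self (pow_ne_zero 2 (norm_ne_zero_iff.mpr hx))

lemma nullCovector_mem_cone {c : ℝ} (hc : c ≠ 0) {x : Sp} (hx : x ≠ 0) :
    (nullCovector c x 0) ^ 2 = c ^ 2 * ((nullCovector c x 1) ^ 2 + (nullCovector c x 2) ^ 2 +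
      (nullCovector c x 3) ^ 2) := by
  have h := sum_sq_div_norm hx
  rw [Fin.sum_univ_three] at h
  change (1 : ℝ) ^ 2 = c ^ 2 * ((-(x 0 / ‖x‖) / c) ^ 2 + (-(x 1 / ‖x‖) / c) ^ 2 +
    (-(x 2 / ‖x‖) / c) ^ 2)
  rw [div_pow _ c, div_pow _ c, div_pow _ c, neg_sq, neg_sq, neg_sq, ← add_div, ← add_div, h]
  field_simp

lemma abs_nullCovector_le {c : ℝ} (hc : 0 < c) (x : Sp) (α : Fin 4) :
    |nullCovector c x α| ≤ 1 + 1 / c := by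
  have hc' : 0 < 1 / c := one_div_pos.mpr hc
  refine Fin.cases ?_ (fun j => ?_) α
  · change |(1 : ℝ)| ≤ _
    rw [abs_one]
    linarith
  · change |-(x j / ‖x‖) / c| ≤ _
    have h : |x j| / ‖x‖ ≤ 1 := div_le_one_of_le₀ (PiLp.norm_apply_le x j) (norm_nonneg x)
    rw [abs_div, abs_neg, abs_div, abs_norm, abs_of_pos hc]
    have := div_le_div_of_nonneg_right h hc.le
    linarith

lemma abs_pd_le_pdNorm (v : Fn) (p : Pt) (α : Fin 4) : |pd α v p| ≤ pdNorm v p :=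
  Real.abs_le_sqrt <|
    Finset.single_le_sum (f := fun α => pd α v p ^ 2) (fun _ _ => sq_nonneg _) (Finset.mem_univ α)

lemma abs_Tder_le_Tnorm (c : ℝ) (v : Fn) (p : Pt) (j : Fin 3) : |Tder c j v p| ≤ Tnorm c v p :=
  Real.abs_le_sqrt <|
    Finset.single_le_sum (f := fun j => Tder c j v p ^ 2) (fun _ _ => sq_nonneg _)
      (Finset.mem_univ j)

/-- Subtracting the null direction from the gradient leaves only good derivatives. -/
lemma abs_pd_sub_nullCovector_le {c : ℝ} (hc : 0 < c) (v : Fn) (p : Pt) (α : Fin 4) :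
    |pd α v p - pt v p * nullCovector c p.2 α| ≤ Tnorm c v p / c := by
  refine Fin.cases ?_ (fun j => ?_) α
  · change |pt v p - pt v p * 1| ≤ _
    rw [mul_one, sub_self, abs_zero]
    exact div_nonneg (Real.sqrt_nonneg _) hc.le
  · change |px j v p - pt v p * (-(p.2 j / ‖p.2‖) / c)| ≤ _
    have h : px j v p - pt v p * (-(p.2 j / ‖p.2‖) / c) = Tder c j v p / c := by
      rw [Tder, eq_div_iff hc.ne', sub_mul, ← mul_div_assoc, div_mul_cancel₀ _ hc.ne']
      ring
    rw [h, abs_div, abs_of_pos hc]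
    exact div_le_div_of_nonneg_right (abs_Tder_le_Tnorm c v p j) hc.le

/-- Pointwise estimate for null forms in terms of the good derivatives. -/
theorem null_form_estimate (c : ℝ) (hc : 0 < c) (H : Fin 4 → Fin 4 → ℝ)
    (hH : nullCond c H) :
    ∃ C : ℝ, 0 < C ∧ ∀ v w : Fn, ContDiff ℝ (⊤ : ℕ∞) v → ContDiff ℝ (⊤ : ℕ∞) w →
      ∀ p : Pt, p.2 ≠ 0 →
        |nullQ H v w p| ≤ C * (Tnorm c v p * pdNorm w p + pdNorm v p * Tnorm c w p) := by
  set M : ℝ := ∑ α, ∑ β, |H α β| with hM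
  have hM0 : 0 ≤ M := Finset.sum_nonneg fun _ _ => Finset.sum_nonneg fun _ _ => abs_nonneg _
  have hc' : 0 < 1 / c := one_div_pos.mpr hc
  refine ⟨M * ((1 + 1 / c) * (1 / c)) + 1, by positivity, fun v w _ _ p hp => ?_⟩
  have hTv : 0 ≤ Tnorm c v p := Real.sqrt_nonneg _
  have hTw : 0 ≤ Tnorm c w p := Real.sqrt_nonneg _
  have hDv : 0 ≤ pdNorm v p := Real.sqrt_nonneg _
  have hDw : 0 ≤ pdNorm w p := Real.sqrt_nonneg _
  have hsX : ∀ α, |pt v p * nullCovector c p.2 α| ≤ pdNorm v p * (1 + 1 / c) := fun α => by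
    rw [abs_mul]
    exact mul_le_mul (abs_pd_le_pdNorm v p 0) (abs_nullCovector_le hc p.2 α) (abs_nonneg _) hDv
  have hA := abs_sum_bilin_le H _ _ (div_nonneg hTv hc.le) (abs_pd_sub_nullCovector_le hc v p)
    (abs_pd_le_pdNorm w p)
  have hB := abs_sum_bilin_le H _ _ (by positivity) hsX (abs_pd_sub_nullCovector_le hc w p)
  rw [← hM] at hA hB
  rw [nullQ, sum_bilin_eq_of_null H (hH _ (nullCovector_mem_cone hc.ne' hp)) (pt v p) (pt w p)
    (fun α => pd α v p) (fun β => pd β w p)]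
  calc _ ≤ _ := abs_add_le _ _
    _ ≤ M * (Tnorm c v p / c * pdNorm w p) +
        M * (pdNorm v p * (1 + 1 / c) * (Tnorm c w p / c)) := add_le_add hA hB
    _ = (M * ((1 + 1 / c) * (1 / c)) + 1) *
          (Tnorm c v p * pdNorm w p + pdNorm v p * Tnorm c w p) -
        (M * (1 / c * (1 / c)) * (Tnorm c v p * pdNorm w p) +
          (Tnorm c v p * pdNorm w p + pdNorm v p * Tnorm c w p)) := by ring
    _ ≤ _ := sub_le_self _ (by positivity)

end MultiSpeedWave
end
end

section
/- Let c > 0. There is a constant C = C(c) such that for every smooth function v(t,x) and all (t,x) with x ≠ 0: |T^{(c)}v(t,x)| ≤ C⟨t⟩^{−1}(|∂_tv(t,x)| + Σ_{i=1}^7 |Z_iv(t,x)| + ⟨ct − r⟩|∂_xv(t,x)|), where r = |x|. -/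
open MeasureTheory Real Set

noncomputable section

namespace MultiSpeedWave

lemma jb_pos (ρ : ℝ) : 0 < jb ρ := Real.sqrt_pos.2 (by positivity)

lemma abs_le_jb (ρ : ℝ) : |ρ| ≤ jb ρ := Real.abs_le_sqrt (by linarith)

lemma jb_le_one_add_abs (ρ : ℝ) : jb ρ ≤ 1 + |ρ| :=
  Real.sqrt_le_iff.2 ⟨by positivity, by nlinarith [sq_abs ρ, abs_nonneg ρ]⟩

lemma abs_px_le_pxNorm (v : Fn) (p : Pt) (j : Fin 3) : |px j v p| ≤ pxNorm v p :=
  Real.abs_le_sqrt <|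
    Finset.single_le_sum (f := fun j => (px j v p) ^ 2) (fun _ _ => sq_nonneg _)
      (Finset.mem_univ j)

lemma abs_coord_div_norm_le_one (x : Sp) (j : Fin 3) : |x j / ‖x‖| ≤ 1 := by
  rw [abs_div, abs_norm]
  exact div_le_one_of_le₀ (PiLp.norm_apply_le x j) (norm_nonneg x)

/-- The good derivative, multiplied by `t`, in terms of the scaling field and the rotations. -/
lemma time_mul_Tder (c : ℝ) (v : Fn) (t : ℝ) {x : Sp} (hx : x ≠ 0) (j : Fin 3) :
    t * Tder c j v (t, x) = (c * t - ‖x‖) * px j v (t, x) + x j / ‖x‖ * sOp v (t, x)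
      + ∑ k : Fin 3, x k / ‖x‖ * om k j v (t, x) := by
  have hr : ‖x‖ ≠ 0 := norm_ne_zero_iff.2 hx
  have hsq : ‖x‖ ^ 2 = x 0 ^ 2 + x 1 ^ 2 + x 2 ^ 2 := by
    rw [EuclideanSpace.real_norm_sq_eq, Fin.sum_univ_three]
  simp only [Tder, sOp, om, Fin.sum_univ_three]
  field_simp
  linear_combination (px j v (t, x)) * hsq

lemma sum_abs_om_le (v : Fn) (p : Pt) (j : Fin 3) :
    ∑ k : Fin 3, |om k j v p| ≤ |om 0 1 v p| + |om 1 2 v p| + |om 0 2 v p| := by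
  have hswap (i k : Fin 3) : |om i k v p| = |om k i v p| := by
    simp only [om]; rw [abs_sub_comm]
  have hdiag (i : Fin 3) : om i i v p = 0 := by simp [om]
  have h0 := abs_nonneg (om 0 1 v p)
  have h1 := abs_nonneg (om 1 2 v p)
  have h2 := abs_nonneg (om 0 2 v p)
  fin_cases j <;>
    simp only [Fin.sum_univ_three, Fin.zero_eta, Fin.mk_one, Fin.reduceFinMk, hdiag, abs_zero,
      hswap 1 0, hswap 2 0, hswap 2 1] <;>
    linarith

lemma sum_abs_Zop (v : Fn) (p : Pt) :
    ∑ i : Fin 7, |Zop i v p| = ∑ j : Fin 3, |px j v p|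
      + (|om 0 1 v p| + |om 1 2 v p| + |om 0 2 v p|) + |sOp v p| := by
  simp only [Zop, Fin.sum_univ_succ, Matrix.cons_val_zero, Matrix.cons_val_succ,
    Finset.univ_eq_empty, Finset.sum_empty]
  simp only [← add_assoc, add_zero]
  rfl

lemma abs_Tder_le (c : ℝ) (hc : 0 ≤ c) (v : Fn) (t : ℝ) (x : Sp) (j : Fin 3) :
    |Tder c j v (t, x)| ≤ c * |px j v (t, x)| + |pt v (t, x)| := by
  refine (abs_add_le _ _).trans ?_
  rw [abs_mul, abs_mul, abs_of_nonneg hc]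
  gcongr
  exact mul_le_of_le_one_left (abs_nonneg _) (abs_coord_div_norm_le_one x j)

lemma abs_time_mul_abs_Tder_le (c : ℝ) (v : Fn) (t : ℝ) {x : Sp} (hx : x ≠ 0) (j : Fin 3) :
    |t| * |Tder c j v (t, x)| ≤ jb (c * t - ‖x‖) * pxNorm v (t, x) + |sOp v (t, x)|
      + (|om 0 1 v (t, x)| + |om 1 2 v (t, x)| + |om 0 2 v (t, x)|) := by
  rw [← abs_mul, time_mul_Tder c v t hx j]
  refine (abs_add_three _ _ _).trans (add_le_add (add_le_add ?_ ?_) ?_)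
  · rw [abs_mul]
    exact mul_le_mul (abs_le_jb _) (abs_px_le_pxNorm v _ j) (abs_nonneg _) (jb_pos _).le
  · rw [abs_mul]
    exact mul_le_of_le_one_left (abs_nonneg _) (abs_coord_div_norm_le_one x j)
  · refine (Finset.abs_sum_le_sum_abs _ _).trans (le_trans ?_ (sum_abs_om_le v (t, x) j))
    refine Finset.sum_le_sum fun k _ => ?_
    rw [abs_mul]
    exact mul_le_of_le_one_left (abs_nonneg _) (abs_coord_div_norm_le_one x k)

lemma jb_mul_abs_Tder_le (c : ℝ) (hc : 0 ≤ c) (v : Fn) (t : ℝ) {x : Sp} (hx : x ≠ 0)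
    (j : Fin 3) :
    jb t * |Tder c j v (t, x)| ≤ (c + 1) *
      (|pt v (t, x)| + ∑ i : Fin 7, |Zop i v (t, x)|
        + jb (c * t - ‖x‖) * pxNorm v (t, x)) := by
  have hpx : |px j v (t, x)| ≤ ∑ j : Fin 3, |px j v (t, x)| :=
    Finset.single_le_sum (f := fun j => |px j v (t, x)|) (fun _ _ => abs_nonneg _)
      (Finset.mem_univ j)
  have hgrad : 0 ≤ jb (c * t - ‖x‖) * pxNorm v (t, x) :=
    mul_nonneg (jb_pos _).le (Real.sqrt_nonneg _)
  have hT := abs_Tder_le c hc v t x j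
  have htT := abs_time_mul_abs_Tder_le c v t hx j
  have hjb := mul_le_mul_of_nonneg_right (jb_le_one_add_abs t) (abs_nonneg (Tder c j v (t, x)))
  rw [sum_abs_Zop]
  have hcpx := mul_le_mul_of_nonneg_left hpx hc
  have hrest : 0 ≤ c * (|pt v (t, x)|
      + (|om 0 1 v (t, x)| + |om 1 2 v (t, x)| + |om 0 2 v (t, x)|) + |sOp v (t, x)|
      + jb (c * t - ‖x‖) * pxNorm v (t, x)) := by positivity
  have hpx0 : 0 ≤ ∑ j : Fin 3, |px j v (t, x)| := by positivity
  linarith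

lemma Tnorm_le_sum_abs (c : ℝ) (v : Fn) (p : Pt) : Tnorm c v p ≤ ∑ j : Fin 3, |Tder c j v p| := by
  refine Real.sqrt_le_iff.2 ⟨by positivity, ?_⟩
  simpa only [sq_abs] using
    Finset.sum_sq_le_sq_sum_of_nonneg (s := Finset.univ) fun j _ => abs_nonneg (Tder c j v p)

/-- Decay estimate for the good derivatives (Lemma 2.2 of Zha). -/
theorem good_derivative_decay (c : ℝ) (hc : 0 < c) :
    ∃ C : ℝ, 0 < C ∧ ∀ v : Fn, ContDiff ℝ (⊤ : ℕ∞) v → ∀ (t : ℝ) (x : Sp), x ≠ 0 →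
      Tnorm c v (t,x) ≤ C * (jb t)⁻¹ *
        (|pt v (t,x)| + ∑ i : Fin 7, |Zop i v (t,x)|
          + jb (c*t - ‖x‖) * pxNorm v (t,x)) := by
  refine ⟨3 * (c + 1), by positivity, fun v _ t x hx => ?_⟩
  have hsum := Finset.sum_le_sum fun (j : Fin 3) (_ : j ∈ Finset.univ) =>
    jb_mul_abs_Tder_le c hc.le v t hx j
  rw [← Finset.mul_sum, Finset.sum_const, Finset.card_univ, Fintype.card_fin, nsmul_eq_mul]
    at hsum
  rw [mul_right_comm, ← div_eq_mul_inv, le_div_iff₀ (jb_pos t), mul_comm]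
  refine (mul_le_mul_of_nonneg_left (Tnorm_le_sum_abs c v (t, x)) (jb_pos t).le).trans ?_
  push_cast at hsum
  linarith

end MultiSpeedWave
end
end

section
/- There exists an absolute constant C > 0 such that for every smooth function v : ℝ³ → ℝ compactly supported (or decaying sufficiently fast at infinity) and every r > 0: r^{1/2}‖v(r·)‖_{L⁴(S²)} ≤ C‖∇v‖_{L²(ℝ³)}, where v(r·) denotes the restriction of v to the sphere of radius r. -/
open MeasureTheory Real Set

noncomputable section

namespace MultiSpeedWave

open scoped ENNReal NNReal

theorem lintegral_eq_lintegral_toSphere {E : Type*} [NormedAddCommGroup E] [NormedSpace ℝ E]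
    [MeasurableSpace E] [BorelSpace E] [FiniteDimensional ℝ E] [Nontrivial E]
    (μ : Measure E) [μ.IsAddHaarMeasure] {f : E → ℝ≥0∞} (hf : Measurable f) :
    ∫⁻ x, f x ∂μ = ∫⁻ ω, (∫⁻ ρ in Ioi (0 : ℝ),
      ENNReal.ofReal (ρ ^ (Module.finrank ℝ E - 1)) * f (ρ • (ω : E))) ∂μ.toSphere := by
  have hcont : Continuous fun p : Metric.sphere (0 : E) 1 × Ioi (0 : ℝ) ↦
      (p.2 : ℝ) • (p.1 : E) := by fun_prop
  calc
    ∫⁻ x, f x ∂μ = ∫⁻ x : ({0}ᶜ : Set E), f x ∂(μ.comap (↑)) := by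
      rw [lintegral_subtype_comap (measurableSet_singleton _).compl, restrict_compl_singleton]
    _ = ∫⁻ p, f ((p.2 : ℝ) • (p.1 : E))
          ∂μ.toSphere.prod (.volumeIoiPow (Module.finrank ℝ E - 1)) := by
      rw [← μ.measurePreserving_homeomorphUnitSphereProd.lintegral_comp_emb
        (Homeomorph.measurableEmbedding _)]
      refine lintegral_congr fun x ↦ ?_
      have hx : ‖(x : E)‖ ≠ 0 := norm_ne_zero_iff.2 x.2
      simp [smul_smul, hx]
    _ = _ := by
      rw [lintegral_prod
        (fun p : Metric.sphere (0 : E) 1 × Ioi (0 : ℝ) ↦ f ((p.2 : ℝ) • (p.1 : E)))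
        (hf.comp hcont.measurable).aemeasurable]
      refine lintegral_congr fun ω ↦ ?_
      have hω : Measurable fun ρ : Ioi (0 : ℝ) ↦ f ((ρ : ℝ) • (ω : E)) :=
        hf.comp (by fun_prop)
      rw [Measure.volumeIoiPow, lintegral_withDensity_eq_lintegral_mul _ (by fun_prop) hω,
        ← lintegral_subtype_comap measurableSet_Ioi]
      rfl

theorem enorm_le_lintegral_Ioi_deriv {f : ℝ → ℝ} (hf : ContDiff ℝ 1 f)
    (hc : HasCompactSupport f) (b : ℝ) : ‖f b‖ₑ ≤ ∫⁻ x in Ioi b, ‖deriv f x‖ₑ := by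
  rw [← enorm_neg, ← hc.integral_Ioi_deriv_eq hf b]
  exact enorm_integral_le_lintegral_enorm _

theorem enorm_pow_four_le_lintegral_ray {E : Type*} [NormedAddCommGroup E] [NormedSpace ℝ E]
    {v : E → ℝ} (hv : ContDiff ℝ 1 v) (hc : HasCompactSupport v) {ω : E} (hω : ‖ω‖ = 1) (r : ℝ) :
    ‖v (r • ω)‖ₑ ^ 4 ≤
      4 * ∫⁻ ρ in Ioi r, ‖v (ρ • ω)‖ₑ ^ 3 * ‖fderiv ℝ v (ρ • ω)‖ₑ := by
  have hcd : ContDiff ℝ 1 fun ρ : ℝ ↦ v (ρ • ω) := hv.comp (by fun_prop)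
  have hcs : HasCompactSupport fun ρ : ℝ ↦ v (ρ • ω) :=
    hc.comp_isClosedEmbedding (isClosedEmbedding_smul_left (norm_ne_zero_iff.1 (by simp [hω])))
  have hcs' : HasCompactSupport fun ρ : ℝ ↦ v (ρ • ω) ^ 4 :=
    hcs.comp_left (g := fun y : ℝ ↦ y ^ 4) (by simp)
  have hderiv (ρ : ℝ) : HasDerivAt (fun ρ : ℝ ↦ v (ρ • ω) ^ 4)
      (4 * v (ρ • ω) ^ 3 * fderiv ℝ v (ρ • ω) ω) ρ := by
    have h := ((hv.differentiable one_ne_zero (ρ • ω)).hasFDerivAt.comp_hasDerivAt ρ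
      ((hasDerivAt_id ρ).smul_const ω)).pow 4
    simpa [Function.comp_def, Pi.pow_def] using h
  rw [← enorm_pow, ← lintegral_const_mul' _ _ (by simp)]
  refine (enorm_le_lintegral_Ioi_deriv (hcd.pow 4) hcs' r).trans (lintegral_mono fun ρ ↦ ?_)
  have hle : ‖fderiv ℝ v (ρ • ω) ω‖ₑ ≤ ‖fderiv ℝ v (ρ • ω)‖ₑ := by
    simpa [enorm_eq_nnnorm, ← NNReal.coe_le_coe, hω] using
      (fderiv ℝ v (ρ • ω)).le_opNorm ω
  have h4 : ‖(4 : ℝ)‖ₑ = 4 := by simp [enorm_eq_nnnorm]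
  rw [(hderiv ρ).deriv, enorm_mul, enorm_mul, enorm_pow, h4, mul_assoc]
  gcongr

theorem sq_mul_lintegral_sphere_le {v : Sp → ℝ} (hv : ContDiff ℝ 1 v) (hc : HasCompactSupport v)
    {r : ℝ} (hr : 0 < r) :
    ENNReal.ofReal (r ^ 2) * ∫⁻ ω : S2, ‖v (r • (ω : Sp))‖ₑ ^ 4 ∂sphMeas ≤
      4 * ∫⁻ x, ‖v x‖ₑ ^ 3 * ‖fderiv ℝ v x‖ₑ := by
  have hv' := hv.continuous
  have hd := hv.continuous_fderiv one_ne_zero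
  rw [lintegral_eq_lintegral_toSphere volume (by fun_prop), finrank_euclideanSpace_fin,
    ← lintegral_const_mul' _ _ (by simp), ← lintegral_const_mul' _ _ (by simp)]
  refine lintegral_mono fun ω ↦ ?_
  calc
    _ ≤ ENNReal.ofReal (r ^ 2) * (4 * ∫⁻ ρ in Ioi r, ‖v (ρ • (ω : Sp))‖ₑ ^ 3 *
          ‖fderiv ℝ v (ρ • (ω : Sp))‖ₑ) := by
      gcongr
      exact enorm_pow_four_le_lintegral_ray hv hc (by simp) r
    _ = 4 * ∫⁻ ρ in Ioi r, ENNReal.ofReal (r ^ 2) * (‖v (ρ • (ω : Sp))‖ₑ ^ 3 *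
          ‖fderiv ℝ v (ρ • (ω : Sp))‖ₑ) := by
      rw [lintegral_const_mul' _ _ (by simp), mul_left_comm]
    _ ≤ 4 * ∫⁻ ρ in Ioi r, ENNReal.ofReal (ρ ^ 2) * (‖v (ρ • (ω : Sp))‖ₑ ^ 3 *
          ‖fderiv ℝ v (ρ • (ω : Sp))‖ₑ) := by
      gcongr 4 * ?_
      refine setLIntegral_mono' measurableSet_Ioi fun ρ (hρ : r < ρ) ↦ ?_
      gcongr
    _ ≤ _ := by
      gcongr 4 * ?_
      exact lintegral_mono_set (Ioi_subset_Ioi hr.le)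

/-- The constant of the Sobolev inequality bounding `‖v‖_{L⁶(ℝ³)}` by `‖∇v‖_{L²(ℝ³)}`. -/
def sobolevConst : ℝ≥0 := eLpNormLESNormFDerivOfEqInnerConst (volume : Measure Sp) 2

theorem lintegral_pow_three_mul_fderiv_le {v : Sp → ℝ} (hv : ContDiff ℝ 1 v)
    (hc : HasCompactSupport v) :
    ∫⁻ x, ‖v x‖ₑ ^ 3 * ‖fderiv ℝ v x‖ₑ ≤
      sobolevConst ^ 3 * (∫⁻ x, ‖fderiv ℝ v x‖ₑ ^ 2) ^ 2 := by
  have hv' := hv.continuous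
  have hd := hv.continuous_fderiv one_ne_zero
  set A := ∫⁻ x, ‖fderiv ℝ v x‖ₑ ^ 2 with hA
  have hSob : (∫⁻ x, ‖v x‖ₑ ^ 6) ^ (1 / 6 : ℝ) ≤ sobolevConst * A ^ (1 / 2 : ℝ) := by
    have h := eLpNorm_le_eLpNorm_fderiv_of_eq_inner (volume : Measure Sp) hv hc (p := 2) (p' := 6)
      (by norm_num) (by simp) (by simp; norm_num)
    rw [eLpNorm_eq_lintegral_rpow_enorm_toReal (by simp) (by simp),
      eLpNorm_eq_lintegral_rpow_enorm_toReal (by simp) (by simp)] at h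
    simpa [hA, sobolevConst] using h
  have hHol : ∫⁻ x, ‖v x‖ₑ ^ 3 * ‖fderiv ℝ v x‖ₑ ≤
      (∫⁻ x, ‖v x‖ₑ ^ 6) ^ (1 / 2 : ℝ) * A ^ (1 / 2 : ℝ) := by
    have h := ENNReal.lintegral_mul_le_Lp_mul_Lq (volume : Measure Sp)
      (Real.HolderConjugate.two_two) (f := fun x ↦ ‖v x‖ₑ ^ 3) (g := fun x ↦ ‖fderiv ℝ v x‖ₑ)
      (by fun_prop) (by fun_prop)
    simpa [← pow_mul, hA] using h
  calc
    _ ≤ ((∫⁻ x, ‖v x‖ₑ ^ 6) ^ (1 / 6 : ℝ)) ^ 3 * A ^ (1 / 2 : ℝ) := by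
      rw [← ENNReal.rpow_mul_natCast]
      norm_num at hHol ⊢
      exact hHol
    _ ≤ (sobolevConst * A ^ (1 / 2 : ℝ)) ^ 3 * A ^ (1 / 2 : ℝ) := by gcongr
    _ = sobolevConst ^ 3 * (A ^ (1 / 2 : ℝ)) ^ 4 := by ring
    _ = _ := by
      rw [← ENNReal.rpow_mul_natCast, ← ENNReal.rpow_natCast A]
      norm_num

theorem norm_fderiv_sq_le_sum_dxj (v : Sp → ℝ) (x : Sp) :
    ‖fderiv ℝ v x‖ ^ 2 ≤ ∑ j : Fin 3, dxj j v x ^ 2 := by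
  have hS : 0 ≤ ∑ j : Fin 3, dxj j v x ^ 2 := by positivity
  rw [← Real.le_sqrt (norm_nonneg _) hS]
  refine ContinuousLinearMap.opNorm_le_bound _ (Real.sqrt_nonneg _) fun y ↦ ?_
  have hy : fderiv ℝ v x y = ∑ j : Fin 3, dxj j v x * y j := by
    conv_lhs => rw [← (EuclideanSpace.basisFun (Fin 3) ℝ).sum_repr y]
    simp [dxj, mul_comm]
  rw [hy, EuclideanSpace.norm_eq, ← Real.sqrt_mul hS, Real.norm_eq_abs]
  refine Real.abs_le_sqrt ?_
  simpa using Finset.sum_mul_sq_le_sq_mul_sq Finset.univ (fun j ↦ dxj j v x) (fun j ↦ y j)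

theorem integrable_sum_dxj_sq {v : Sp → ℝ} (hv : ContDiff ℝ 1 v) (hc : HasCompactSupport v) :
    Integrable fun x ↦ ∑ j : Fin 3, dxj j v x ^ 2 := by
  have hcont (j : Fin 3) : Continuous (dxj j v) :=
    (hv.continuous_fderiv one_ne_zero).clm_apply continuous_const
  have hsupp (j : Fin 3) : HasCompactSupport (dxj j v) := hc.fderiv_apply (𝕜 := ℝ) _
  have hsq (j : Fin 3) : HasCompactSupport fun x ↦ dxj j v x ^ 2 := by
    simpa only [pow_two, Pi.mul_def] using (hsupp j).mul_left (f' := dxj j v)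
  exact integrable_finsetSum _ fun j _ ↦
    ((hcont j).pow 2).integrable_of_hasCompactSupport (hsq j)

theorem lintegral_fderiv_sq_le {v : Sp → ℝ} (hv : ContDiff ℝ 1 v) (hc : HasCompactSupport v) :
    ∫⁻ x, ‖fderiv ℝ v x‖ₑ ^ 2 ≤ ENNReal.ofReal (∫ x, ∑ j : Fin 3, dxj j v x ^ 2) := by
  rw [ofReal_integral_eq_lintegral_ofReal (integrable_sum_dxj_sq hv hc)
    (.of_forall fun x ↦ Finset.sum_nonneg fun j _ ↦ sq_nonneg _)]
  refine lintegral_mono fun x ↦ ?_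
  rw [← ofReal_norm, ← ENNReal.ofReal_pow (norm_nonneg _)]
  exact ENNReal.ofReal_le_ofReal (norm_fderiv_sq_le_sum_dxj v x)

theorem sq_mul_integral_sphere_le {v : Sp → ℝ} (hv : ContDiff ℝ 1 v) (hc : HasCompactSupport v)
    {r : ℝ} (hr : 0 < r) :
    r ^ 2 * ∫ ω : S2, |v (r • (ω : Sp))| ^ 4 ∂sphMeas ≤
      4 * sobolevConst ^ 3 * (∫ x, ∑ j : Fin 3, dxj j v x ^ 2) ^ 2 := by
  have hv' := hv.continuous
  have hB : 0 ≤ ∫ x, ∑ j : Fin 3, dxj j v x ^ 2 := integral_nonneg fun x ↦ by positivity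
  rw [integral_eq_lintegral_of_nonneg_ae (.of_forall fun ω ↦ by positivity)
    (by fun_prop : Continuous _).aestronglyMeasurable,
    ← ENNReal.toReal_ofReal (sq_nonneg r), ← ENNReal.toReal_mul]
  refine ENNReal.toReal_le_of_le_ofReal (by positivity) ?_
  simp_rw [ENNReal.ofReal_pow (abs_nonneg _), ← Real.norm_eq_abs, ofReal_norm]
  calc
    _ ≤ 4 * ∫⁻ x, ‖v x‖ₑ ^ 3 * ‖fderiv ℝ v x‖ₑ := sq_mul_lintegral_sphere_le hv hc hr
    _ ≤ 4 * (sobolevConst ^ 3 * (∫⁻ x, ‖fderiv ℝ v x‖ₑ ^ 2) ^ 2) := by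
      gcongr
      exact lintegral_pow_three_mul_fderiv_le hv hc
    _ ≤ 4 * (sobolevConst ^ 3 * ENNReal.ofReal (∫ x, ∑ j : Fin 3, dxj j v x ^ 2) ^ 2) := by
      gcongr
      exact lintegral_fderiv_sq_le hv hc
    _ = _ := by
      rw [ENNReal.ofReal_mul (by positivity), ENNReal.ofReal_mul (by positivity),
        ENNReal.ofReal_pow hB, ENNReal.ofReal_pow (by positivity), ENNReal.ofReal_coe_nnreal,
        ENNReal.ofReal_ofNat, mul_assoc]

/-- The trace inequality `r^{1/2}‖v(r·)‖_{L⁴(S²)} ≤ C‖∇v‖_{L²(ℝ³)}`. -/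
theorem trace_inequality :
    ∃ C : ℝ, 0 < C ∧ ∀ v : Sp → ℝ, ContDiff ℝ (⊤ : ℕ∞) v → HasCompactSupport v →
      ∀ r : ℝ, 0 < r →
        Real.sqrt r * L4sph v r ≤
          C * Real.sqrt (∫ x : Sp, ∑ j : Fin 3, (dxj j v x)^2) := by
  have hK : (0 : ℝ) ≤ 4 * sobolevConst ^ 3 := by positivity
  refine ⟨(4 * sobolevConst ^ 3 : ℝ) ^ (1 / 4 : ℝ) + 1, by positivity, fun v hv hc r hr ↦ ?_⟩
  have hB : 0 ≤ ∫ x, ∑ j : Fin 3, dxj j v x ^ 2 := integral_nonneg fun x ↦ by positivity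
  have hI : 0 ≤ ∫ ω : S2, |v (r • (ω : Sp))| ^ 4 ∂sphMeas := integral_nonneg fun ω ↦ by positivity
  have hroot {a : ℝ} (ha : 0 ≤ a) : √a = (a ^ 2) ^ (1 / 4 : ℝ) := by
    rw [Real.sqrt_eq_rpow, ← Real.rpow_natCast, ← Real.rpow_mul ha]
    norm_num
  calc
    _ = (r ^ 2 * ∫ ω : S2, |v (r • (ω : Sp))| ^ 4 ∂sphMeas) ^ (1 / 4 : ℝ) := by
      rw [Real.mul_rpow (sq_nonneg r) hI, hroot hr.le, L4sph]
    _ ≤ (4 * sobolevConst ^ 3 * (∫ x, ∑ j : Fin 3, dxj j v x ^ 2) ^ 2) ^ (1 / 4 : ℝ) :=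
      Real.rpow_le_rpow (by positivity)
        (sq_mul_integral_sphere_le (hv.of_le (by exact_mod_cast le_top)) hc hr) (by norm_num)
    _ = (4 * sobolevConst ^ 3 : ℝ) ^ (1 / 4 : ℝ) * √(∫ x, ∑ j : Fin 3, dxj j v x ^ 2) := by
      rw [Real.mul_rpow hK (sq_nonneg _), hroot hB]
    _ ≤ _ := by
      gcongr
      exact le_add_of_nonneg_right zero_le_one

end MultiSpeedWave
end
end
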